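/- arXiv:1003.2218 — 2 statements merged into one kernel-verified Lean document; each statement's English description precedes it below -/
import Mathlib

section
/- Let Ω be a finite nonempty set and (Ω,Λ) a game satisfying Assumptions 1 and 2, and let η > 0. For x in the open positive orthant U := {x ∈ ℝ^Ω : x(ω) > 0 for all ω}, define H(x) := inf_{g ∈ Σ_Λ^η} ∑_{ω∈Ω} x(ω)·g(ω), the sum taken in [0,∞] (H(x) is then a finite nonnegative real and the infimum is attained). Then: (a) for every π ∈ 𝒫°(Ω) there is exactly one γ_π ∈ Σ_Λ^η with ∑_ω π(ω)·γ_π(ω) = H(π), and every coordinate of γ_π is finite; (b) H is differentiable at every π ∈ 𝒫°(Ω), and the gradient of H at π equals γ_π (viewed as a vector in ℝ^Ω); (c) the map π ↦ γ_π is continuous on 𝒫°(Ω). -/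
open scoped ENNReal BigOperators
open Filter

noncomputable section

variable {Ω : Type*} [Fintype Ω]

/-- `pexp r t = exp(r·t)` for `t ∈ [0,∞]`, with value `∞` when `t = ∞`. -/
def pexp (r : ℝ) (t : ℝ≥0∞) : ℝ≥0∞ :=
  if t = ∞ then ∞ else ENNReal.ofReal (Real.exp (r * t.toReal))

/-- `nexp r t = exp(−r·t)` for `t ∈ [0,∞]`, with value `0` when `t = ∞`. -/
def nexp (r : ℝ) (t : ℝ≥0∞) : ℝ≥0∞ :=
  if t = ∞ then 0 else ENNReal.ofReal (Real.exp (-(r * t.toReal)))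

/-- Expectation `E_π g = ∑_{ω : π ω ≠ 0} π(ω)·g(ω)` in `[0,∞]` (since `0·∞ = 0` in
`ℝ≥0∞`, the terms with `π ω = 0` contribute nothing, so we may sum over all `ω`). -/
def expect (π : Ω → ℝ) (g : Ω → ℝ≥0∞) : ℝ≥0∞ :=
  ∑ ω, ENNReal.ofReal (π ω) * g ω

/-- The superprediction set `Σ_Λ` of a game `(Ω, Λ)`. -/
def superpred (Λ : Set (Ω → ℝ≥0∞)) : Set (Ω → ℝ≥0∞) :=
  {g | ∃ γ ∈ Λ, ∀ ω, γ ω ≤ g ω}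

/-- `−(1/η)·ln x`, with value `∞` at `x = 0`. -/
def negLogDiv (η : ℝ) (x : ℝ≥0∞) : ℝ≥0∞ :=
  if x = 0 then ∞ else ENNReal.ofReal (-(1 / η) * Real.log x.toReal)

/-- The exp-convex hull `Σ_Λ^η` of the superprediction set. -/
def expHull (η : ℝ) (Λ : Set (Ω → ℝ≥0∞)) : Set (Ω → ℝ≥0∞) :=
  {g | ∃ k : ℕ, 0 < k ∧ ∃ (gs : Fin k → Ω → ℝ≥0∞) (ρ : Fin k → ℝ),
    (∀ i, gs i ∈ superpred Λ) ∧ (∀ i, 0 ≤ ρ i) ∧ (∑ i, ρ i = 1) ∧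
    ∀ ω, g ω = negLogDiv η (∑ i, ENNReal.ofReal (ρ i) * nexp η (gs i ω))}

/-- The set of minimal elements of `X`. -/
def minSet (X : Set (Ω → ℝ≥0∞)) : Set (Ω → ℝ≥0∞) :=
  {g | g ∈ X ∧ ∀ g' ∈ X, (∀ ω, g' ω ≤ g ω) → g' = g}

/-- The generalized entropy `H(x) = inf_{g ∈ Σ_Λ^η} ∑_ω x(ω)·g(ω)`, computed in `[0,∞]`. -/
def entropyE (η : ℝ) (Λ : Set (Ω → ℝ≥0∞)) (x : Ω → ℝ) : ℝ≥0∞ :=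
  ⨅ g ∈ expHull η Λ, ∑ ω, ENNReal.ofReal (x ω) * g ω

/-- The generalized entropy as a real-valued function on `ℝ^Ω`. -/
def entropy (η : ℝ) (Λ : Set (Ω → ℝ≥0∞)) (x : Ω → ℝ) : ℝ :=
  (entropyE η Λ x).toReal

theorem isCompact_convexHull_of_finiteDimensional {E : Type*} [NormedAddCommGroup E]
    [NormedSpace ℝ E] [FiniteDimensional ℝ E] {s : Set E} (hs : IsCompact s) :
    IsCompact (convexHull ℝ s) := by
  let n := Module.finrank ℝ E + 1
  let f : (Fin n → ℝ) × (Fin n → E) → E := fun p => ∑ i, p.1 i • p.2 i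
  have hf : Continuous f := by fun_prop
  have hc : IsCompact (stdSimplex ℝ (Fin n) ×ˢ Set.univ.pi fun _ : Fin n => s) :=
    (isCompact_stdSimplex ℝ (Fin n)).prod (isCompact_univ_pi fun _ => hs)
  convert hc.image hf using 1
  ext x
  constructor
  · intro hx
    obtain ⟨ι, _, z, w, hz, hind, hw, hw1, hx⟩ := eq_pos_convex_span_of_mem_convexHull hx
    have hcard : Fintype.card ι ≤ Fintype.card (Fin n) := by
      have := hind.card_le_finrank_succ
      have h2 := Submodule.finrank_le (vectorSpan ℝ (Set.range z))
      simp only [Fintype.card_fin, n]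
      lia
    obtain ⟨e⟩ := Function.Embedding.nonempty_of_card_le hcard
    have hne : Nonempty ι := by
      by_contra h
      rw [not_nonempty_iff] at h
      simp at hw1
    obtain ⟨i₀⟩ := hne
    have hext : ∀ i, Function.extend e w 0 (e i) = w i := fun i => e.injective.extend_apply _ _ _
    have hext' : ∀ i, Function.extend e z (fun _ => z i₀) (e i) = z i :=
      fun i => e.injective.extend_apply _ _ _
    have hoff : ∀ j, j ∉ Set.range e → Function.extend e w 0 j = 0 := fun j hj =>
      Function.extend_apply' _ _ _ hj
    refine ⟨(Function.extend e w 0, Function.extend e z fun _ => z i₀), ⟨⟨?_, ?_⟩, ?_⟩, ?_⟩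
    · intro j
      by_cases hj : j ∈ Set.range e
      · obtain ⟨i, rfl⟩ := hj
        exact (hw i).le.trans_eq (hext i).symm
      · exact (hoff j hj).ge
    · rw [← hw1]
      exact (Fintype.sum_of_injective e e.injective _ _ hoff fun i => (hext i).symm).symm
    · intro j _
      by_cases hj : j ∈ Set.range e
      · obtain ⟨i, rfl⟩ := hj
        simp only [hext']
        exact hz ⟨i, rfl⟩
      · simp only [Function.extend_apply' _ _ _ hj]
        exact hz ⟨i₀, rfl⟩
    · rw [← hx]
      refine (Fintype.sum_of_injective e e.injective _ _ (fun j hj => ?_) fun i => ?_).symm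
      · simp [hoff j hj]
      · simp [hext, hext']
  · rintro ⟨⟨w, z⟩, ⟨⟨hw, hw1⟩, hz⟩, rfl⟩
    exact mem_convexHull_of_exists_fintype w z hw hw1 (fun i => hz i trivial) rfl

theorem isCompact_superpred {ι : Type*} {Λ : Set (ι → ℝ≥0∞)} (hΛ : IsCompact Λ) :
    IsCompact (superpred Λ) := by
  have hcl : IsClosed {p : (ι → ℝ≥0∞) × (ι → ℝ≥0∞) | p.1 ≤ p.2} := isClosed_le_prod
  convert ((hΛ.prod isCompact_univ).inter_right hcl).image continuous_snd using 1
  ext g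
  constructor
  · rintro ⟨γ, hγ, h⟩
    exact ⟨(γ, g), ⟨⟨hγ, trivial⟩, h⟩, rfl⟩
  · rintro ⟨⟨γ, g⟩, ⟨⟨hγ, -⟩, h⟩, rfl⟩
    exact ⟨γ, hγ, h⟩

theorem continuous_nexp {η : ℝ} (hη : 0 < η) : Continuous (nexp η) := by
  have h : nexp η = fun t => EReal.exp (-((ENNReal.ofReal η * t : ℝ≥0∞) : EReal)) := by
    funext t
    unfold nexp
    split_ifs with ht
    · simp [ht, ENNReal.mul_top, hη]
    · lift t to NNReal using ht
      rw [← EReal.exp_coe, ← ENNReal.ofReal_coe_nnreal, ← ENNReal.ofReal_mul hη.le,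
        EReal.coe_ennreal_ofReal, max_eq_left (by positivity)]
      simp
  rw [h]
  exact ENNReal.continuous_exp.comp (continuous_neg.comp (continuous_coe_ennreal_ereal.comp
    (ENNReal.continuous_const_mul ENNReal.ofReal_ne_top)))

theorem nexp_le_one {η : ℝ} (hη : 0 < η) (t : ℝ≥0∞) : nexp η t ≤ 1 := by
  unfold nexp
  split_ifs
  · simp
  · rw [ENNReal.ofReal_le_one, Real.exp_le_one_iff]
    have := ENNReal.toReal_nonneg (a := t)
    nlinarith

theorem negLogDiv_nexp {η : ℝ} (hη : 0 < η) (t : ℝ≥0∞) : negLogDiv η (nexp η t) = t := by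
  unfold nexp negLogDiv
  by_cases ht : t = ∞
  · simp [ht]
  · have : ¬ ENNReal.ofReal (Real.exp (-(η * t.toReal))) = 0 := by
      simp [Real.exp_pos]
    rw [if_neg ht, if_neg this, ENNReal.toReal_ofReal (Real.exp_pos _).le, Real.log_exp]
    rw [show -(1 / η) * -(η * t.toReal) = t.toReal by field_simp, ENNReal.ofReal_toReal ht]

theorem nexp_negLogDiv {η : ℝ} (hη : 0 < η) {s : ℝ≥0∞} (hs : s ≤ 1) :
    nexp η (negLogDiv η s) = s := by
  unfold nexp negLogDiv
  by_cases h0 : s = 0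
  · simp [h0]
  · have hs' : s ≠ ∞ := ne_top_of_le_ne_top ENNReal.one_ne_top hs
    have hpos : 0 < s.toReal := ENNReal.toReal_pos h0 hs'
    have hle : s.toReal ≤ 1 := ENNReal.toReal_le_of_le_ofReal zero_le_one (by simpa using hs)
    have hlog : 0 ≤ -(1 / η) * Real.log s.toReal :=
      mul_nonneg_of_nonpos_of_nonpos (by simp [hη.le]) (Real.log_nonpos hpos.le hle)
    rw [if_neg h0, if_neg ENNReal.ofReal_ne_top, ENNReal.toReal_ofReal hlog,
      show -(η * (-(1 / η) * Real.log s.toReal)) = Real.log s.toReal by field_simp,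
      Real.exp_log hpos, ENNReal.ofReal_toReal hs']

/-- The exponential transform `t ↦ exp(−η·t)` applied to each coordinate, with real values. -/
def expTransform (η : ℝ) (g : Ω → ℝ≥0∞) : Ω → ℝ := fun ω => (nexp η (g ω)).toReal

theorem ofReal_expTransform {ι : Type*} {η : ℝ} (hη : 0 < η) (g : ι → ℝ≥0∞) (ω : ι) :
    ENNReal.ofReal (expTransform η g ω) = nexp η (g ω) :=
  ENNReal.ofReal_toReal (ne_top_of_le_ne_top ENNReal.one_ne_top (nexp_le_one hη _))

theorem continuous_expTransform {ι : Type*} {η : ℝ} (hη : 0 < η) :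
    Continuous (expTransform η : (ι → ℝ≥0∞) → ι → ℝ) :=
  continuous_pi fun ω => ENNReal.continuousOn_toReal.comp_continuous
    ((continuous_nexp hη).comp (continuous_apply ω))
    fun _ => ne_top_of_le_ne_top ENNReal.one_ne_top (nexp_le_one hη _)

theorem sum_nexp_eq {η : ℝ} (hη : 0 < η) {ι κ : Type*} [Fintype κ] {ρ : κ → ℝ}
    (hρ : ∀ i, 0 ≤ ρ i) (gs : κ → ι → ℝ≥0∞) (ω : ι) :
    ∑ i, ENNReal.ofReal (ρ i) * nexp η (gs i ω) =
      ENNReal.ofReal ((∑ i, ρ i • expTransform η (gs i)) ω) := by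
  have hnn : ∀ i, 0 ≤ expTransform η (gs i) ω := fun i => ENNReal.toReal_nonneg
  rw [Finset.sum_apply, ENNReal.ofReal_sum_of_nonneg]
  · refine Finset.sum_congr rfl fun i _ => ?_
    rw [Pi.smul_apply, smul_eq_mul, ENNReal.ofReal_mul (hρ i), ofReal_expTransform hη]
  · exact fun i _ => mul_nonneg (hρ i) (hnn i)

theorem mem_expHull_iff {ι : Type*} {η : ℝ} (hη : 0 < η) {Λ : Set (ι → ℝ≥0∞)} {g : ι → ℝ≥0∞} :
    g ∈ expHull η Λ ↔
      expTransform η g ∈ convexHull ℝ (expTransform η '' superpred Λ) := by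
  constructor
  · rintro ⟨k, -, gs, ρ, hgs, hρ, hρ1, hg⟩
    refine mem_convexHull_of_exists_fintype ρ (fun i => expTransform η (gs i)) hρ hρ1
      (fun i => ⟨_, hgs i, rfl⟩) ?_
    funext ω
    have hle : ∑ i, ENNReal.ofReal (ρ i) * nexp η (gs i ω) ≤ 1 :=
      calc _ ≤ ∑ i, ENNReal.ofReal (ρ i) * 1 := by
            gcongr; exact nexp_le_one hη _
        _ = 1 := by
            simp only [mul_one]
            rw [← ENNReal.ofReal_sum_of_nonneg fun i _ => hρ i, hρ1, ENNReal.ofReal_one]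
    have hnn : 0 ≤ (∑ i, ρ i • expTransform η (gs i)) ω := by
      rw [Finset.sum_apply]
      exact Finset.sum_nonneg fun i _ => mul_nonneg (hρ i) ENNReal.toReal_nonneg
    rw [expTransform, hg, nexp_negLogDiv hη hle, sum_nexp_eq hη hρ, ENNReal.toReal_ofReal hnn]
  · intro h
    obtain ⟨κ, _, ρ, z, hρ, hρ1, hz, hx⟩ := mem_convexHull_iff_exists_fintype.1 h
    choose gs hgs hgz using hz
    have hk : 0 < Fintype.card κ := by
      rw [Fintype.card_pos_iff]
      by_contra h
      rw [not_nonempty_iff] at h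
      simp at hρ1
    let e := (Fintype.equivFin κ).symm
    refine ⟨Fintype.card κ, hk, fun i => gs (e i), fun i => ρ (e i), fun i => hgs _,
      fun i => hρ _, by rw [← hρ1]; exact e.sum_comp ρ, fun ω => ?_⟩
    rw [e.sum_comp fun i => ENNReal.ofReal (ρ i) * nexp η (gs i ω), sum_nexp_eq hη hρ]
    simp only [hgz]
    rw [hx, ofReal_expTransform hη, negLogDiv_nexp hη]

theorem isCompact_expHull {η : ℝ} (hη : 0 < η) {Λ : Set (Ω → ℝ≥0∞)} (hΛ : IsCompact Λ) :
    IsCompact (expHull η Λ) := by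
  have h : expHull η Λ =
      expTransform η ⁻¹' convexHull ℝ (expTransform η '' superpred Λ) :=
    Set.ext fun _ => mem_expHull_iff hη
  rw [h]
  exact ((isCompact_convexHull_of_finiteDimensional ((isCompact_superpred hΛ).image
    (continuous_expTransform hη))).isClosed.preimage (continuous_expTransform hη)).isCompact

theorem subset_expHull {ι : Type*} {η : ℝ} (hη : 0 < η) (Λ : Set (ι → ℝ≥0∞)) : Λ ⊆ expHull η Λ :=
  fun g hg => (mem_expHull_iff hη).2
    (subset_convexHull _ _ ⟨g, ⟨g, hg, fun _ => le_rfl⟩, rfl⟩)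

theorem neg_log_half_add_exp_le {η : ℝ} (hη : 0 < η) (a b : ℝ) :
    -(1 / η) * Real.log ((Real.exp (-(η * a)) + Real.exp (-(η * b))) / 2) ≤ (a + b) / 2 ∧
    (a ≠ b →
      -(1 / η) * Real.log ((Real.exp (-(η * a)) + Real.exp (-(η * b))) / 2) < (a + b) / 2) := by
  have hsq : ∀ c : ℝ, Real.exp (-(η * c)) = Real.exp (-(η * c) / 2) ^ 2 := fun c => by
    rw [← Real.exp_nat_mul]; congr 1; push_cast; ring
  have hprod : Real.exp (-(η * ((a + b) / 2))) =
      Real.exp (-(η * a) / 2) * Real.exp (-(η * b) / 2) := by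
    rw [← Real.exp_add]; congr 1; ring
  have hmid : (a + b) / 2 = -(1 / η) * -(η * ((a + b) / 2)) := by field_simp
  have hneg : -(1 / η) < 0 := by simp [hη]
  rw [hmid]
  constructor
  · apply mul_le_mul_of_nonpos_left _ hneg.le
    rw [Real.le_log_iff_exp_le (by positivity), hprod, hsq a, hsq b]
    nlinarith [sq_nonneg (Real.exp (-(η * a) / 2) - Real.exp (-(η * b) / 2))]
  · intro hab
    apply mul_lt_mul_of_neg_left _ hneg
    rw [Real.lt_log_iff_exp_lt (by positivity), hprod, hsq a, hsq b]
    have hne : Real.exp (-(η * a) / 2) - Real.exp (-(η * b) / 2) ≠ 0 := by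
      rw [sub_ne_zero, Real.exp_injective.ne_iff]
      intro h
      exact hab (mul_left_cancel₀ hη.ne' (by linarith))
    nlinarith [sq_pos_of_ne_zero hne]

/-- Every pair of distinct finite points of `K` has a finite point of `K` below its midpoint. -/
def MidpointStrict (K : Set (Ω → ℝ≥0∞)) : Prop :=
  ∀ g ∈ K, ∀ g' ∈ K, (∀ ω, g ω ≠ ∞) → (∀ ω, g' ω ≠ ∞) → g ≠ g' →
    ∃ h ∈ K, (∀ ω, h ω ≠ ∞) ∧
      (∀ ω, (h ω).toReal ≤ ((g ω).toReal + (g' ω).toReal) / 2) ∧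
      ∃ ω, (h ω).toReal < ((g ω).toReal + (g' ω).toReal) / 2

theorem midpointStrict_expHull {ι : Type*} {η : ℝ} (hη : 0 < η) (Λ : Set (ι → ℝ≥0∞)) :
    MidpointStrict (expHull η Λ) := by
  intro g hg g' hg' hgt hgt' hne
  have hT : ∀ {f : ι → ℝ≥0∞}, (∀ ω, f ω ≠ ∞) → ∀ ω,
      expTransform η f ω = Real.exp (-(η * (f ω).toReal)) := fun {f} hf ω => by
    rw [expTransform, nexp, if_neg (hf ω), ENNReal.toReal_ofReal (Real.exp_pos _).le]
  let m : ι → ℝ := fun ω =>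
    (Real.exp (-(η * (g ω).toReal)) + Real.exp (-(η * (g' ω).toReal))) / 2
  have hm0 : ∀ ω, 0 < m ω := fun ω => by positivity
  have hm1 : ∀ ω, m ω ≤ 1 := fun ω => by
    have h1 : ∀ t : ℝ≥0∞, Real.exp (-(η * t.toReal)) ≤ 1 := fun t =>
      Real.exp_le_one_iff.2 (by have := ENNReal.toReal_nonneg (a := t); nlinarith)
    have := h1 (g ω)
    have := h1 (g' ω)
    simp only [m]
    linarith
  let h : ι → ℝ≥0∞ := fun ω => negLogDiv η (ENNReal.ofReal (m ω))
  have hval : ∀ ω, h ω = ENNReal.ofReal (-(1 / η) * Real.log (m ω)) := fun ω => by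
    simp only [h, negLogDiv]
    rw [if_neg (by simpa using hm0 ω), ENNReal.toReal_ofReal (hm0 ω).le]
  have hreal : ∀ ω, (h ω).toReal = -(1 / η) * Real.log (m ω) := fun ω => by
    rw [hval, ENNReal.toReal_ofReal]
    exact mul_nonneg_of_nonpos_of_nonpos (by simp [hη.le]) (Real.log_nonpos (hm0 ω).le (hm1 ω))
  refine ⟨h, ?_, fun ω => hval ω ▸ ENNReal.ofReal_ne_top, fun ω => ?_, ?_⟩
  · rw [mem_expHull_iff hη] at hg hg' ⊢
    convert (convex_convexHull ℝ _) hg hg' (a := 1 / 2) (b := 1 / 2) (by norm_num) (by norm_num)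
      (by norm_num) using 1
    funext ω
    simp only [Pi.add_apply, Pi.smul_apply, smul_eq_mul, hT hgt, hT hgt']
    rw [expTransform, nexp_negLogDiv hη (ENNReal.ofReal_le_one.2 (hm1 ω)),
      ENNReal.toReal_ofReal (hm0 ω).le]
    simp only [m]
    ring
  · rw [hreal]
    exact (neg_log_half_add_exp_le hη _ _).1
  · obtain ⟨ω, hω⟩ := Function.ne_iff.1 hne
    refine ⟨ω, ?_⟩
    rw [hreal]
    exact (neg_log_half_add_exp_le hη _ _).2
      fun h => hω ((ENNReal.toReal_eq_toReal_iff' (hgt ω) (hgt' ω)).1 h)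

theorem sum_ofReal_mul_eq {x : Ω → ℝ} (hx : ∀ ω, 0 < x ω) {g : Ω → ℝ≥0∞}
    (hg : ∀ ω, g ω ≠ ∞) :
    ∑ ω, ENNReal.ofReal (x ω) * g ω = ENNReal.ofReal (∑ ω, x ω * (g ω).toReal) := by
  rw [ENNReal.ofReal_sum_of_nonneg fun ω _ => mul_nonneg (hx ω).le ENNReal.toReal_nonneg]
  refine Finset.sum_congr rfl fun ω _ => ?_
  rw [ENNReal.ofReal_mul (hx ω).le, ENNReal.ofReal_toReal (hg ω)]

theorem ne_top_of_sum_ofReal_mul_ne_top {x : Ω → ℝ} (hx : ∀ ω, 0 < x ω) {g : Ω → ℝ≥0∞}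
    (h : ∑ ω, ENNReal.ofReal (x ω) * g ω ≠ ∞) (ω : Ω) : g ω ≠ ∞ := by
  intro hg
  refine ENNReal.sum_ne_top.1 h ω (Finset.mem_univ ω) ?_
  rw [hg, ENNReal.mul_top (by simpa using hx ω)]

/-- `g` minimizes the linear functional with weights `x` over `K`. -/
def IsMinimizer (K : Set (Ω → ℝ≥0∞)) (x : Ω → ℝ) (g : Ω → ℝ≥0∞) : Prop :=
  g ∈ K ∧ ∀ g' ∈ K, ∑ ω, ENNReal.ofReal (x ω) * g ω ≤ ∑ ω, ENNReal.ofReal (x ω) * g' ω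

theorem exists_isMinimizer {K : Set (Ω → ℝ≥0∞)} (hK : IsCompact K) (hne : K.Nonempty)
    (x : Ω → ℝ) : ∃ g, IsMinimizer K x g := by
  have hcont : Continuous fun g : Ω → ℝ≥0∞ => ∑ ω, ENNReal.ofReal (x ω) * g ω :=
    continuous_finsetSum _ fun ω _ =>
      (ENNReal.continuous_const_mul ENNReal.ofReal_ne_top).comp (continuous_apply ω)
  obtain ⟨g, hg, hmin⟩ := hK.exists_isMinOn hne hcont.continuousOn
  exact ⟨g, hg, fun g' hg' => hmin hg'⟩

namespace IsMinimizer

variable {K : Set (Ω → ℝ≥0∞)} {x : Ω → ℝ} {g g' : Ω → ℝ≥0∞}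

theorem sum_eq_iInf (h : IsMinimizer K x g) :
    ∑ ω, ENNReal.ofReal (x ω) * g ω = ⨅ f ∈ K, ∑ ω, ENNReal.ofReal (x ω) * f ω :=
  le_antisymm (le_iInf₂ h.2) (iInf₂_le g h.1)

theorem of_sum_eq_iInf (hg : g ∈ K)
    (h : ∑ ω, ENNReal.ofReal (x ω) * g ω = ⨅ f ∈ K, ∑ ω, ENNReal.ofReal (x ω) * f ω) :
    IsMinimizer K x g :=
  ⟨hg, fun f hf => h.trans_le (iInf₂_le f hf)⟩

theorem sum_ne_top (hfin : ∃ f ∈ K, ∀ ω, f ω ≠ ∞) (h : IsMinimizer K x g) :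
    ∑ ω, ENNReal.ofReal (x ω) * g ω ≠ ∞ := by
  obtain ⟨f, hf, hft⟩ := hfin
  exact ne_top_of_le_ne_top (ENNReal.sum_ne_top.2 fun ω _ =>
    ENNReal.mul_ne_top ENNReal.ofReal_ne_top (hft ω)) (h.2 f hf)

theorem ne_top (hfin : ∃ f ∈ K, ∀ ω, f ω ≠ ∞) (hx : ∀ ω, 0 < x ω) (h : IsMinimizer K x g)
    (ω : Ω) : g ω ≠ ∞ :=
  ne_top_of_sum_ofReal_mul_ne_top hx (h.sum_ne_top hfin) ω

theorem sum_toReal_le (hx : ∀ ω, 0 < x ω) (h : IsMinimizer K x g) (hg : ∀ ω, g ω ≠ ∞)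
    (hgK : g' ∈ K) (hg' : ∀ ω, g' ω ≠ ∞) :
    ∑ ω, x ω * (g ω).toReal ≤ ∑ ω, x ω * (g' ω).toReal := by
  have := h.2 g' hgK
  rwa [sum_ofReal_mul_eq hx hg, sum_ofReal_mul_eq hx hg', ENNReal.ofReal_le_ofReal_iff
    (Finset.sum_nonneg fun ω _ => mul_nonneg (hx ω).le ENNReal.toReal_nonneg)] at this

theorem unique (hK : MidpointStrict K) (hfin : ∃ f ∈ K, ∀ ω, f ω ≠ ∞) (hx : ∀ ω, 0 < x ω)
    (hg : IsMinimizer K x g) (hg' : IsMinimizer K x g') : g = g' := by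
  by_contra hne
  have hgt := hg.ne_top hfin hx
  have hgt' := hg'.ne_top hfin hx
  obtain ⟨h, hhK, hht, hle, ω₀, hlt⟩ := hK g hg.1 g' hg'.1 hgt hgt' hne
  have h1 := hg.sum_toReal_le hx hgt hhK hht
  have h2 := hg'.sum_toReal_le hx hgt' hhK hht
  have h3 : ∑ ω, x ω * (h ω).toReal <
      ∑ ω, x ω * (((g ω).toReal + (g' ω).toReal) / 2) :=
    Finset.sum_lt_sum (fun ω _ => mul_le_mul_of_nonneg_left (hle ω) (hx ω).le)
      ⟨ω₀, Finset.mem_univ _, mul_lt_mul_of_pos_left hlt (hx ω₀)⟩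
  have h4 : ∑ ω, x ω * (((g ω).toReal + (g' ω).toReal) / 2) =
      (∑ ω, x ω * (g ω).toReal + ∑ ω, x ω * (g' ω).toReal) / 2 := by
    rw [← Finset.sum_add_distrib, Finset.sum_div]
    exact Finset.sum_congr rfl fun ω _ => by ring
  linarith

theorem toReal_iInf (hx : ∀ ω, 0 < x ω) (h : IsMinimizer K x g) (hg : ∀ ω, g ω ≠ ∞) :
    (⨅ f ∈ K, ∑ ω, ENNReal.ofReal (x ω) * f ω).toReal = ∑ ω, x ω * (g ω).toReal := by
  rw [← h.sum_eq_iInf, sum_ofReal_mul_eq hx hg, ENNReal.toReal_ofReal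
    (Finset.sum_nonneg fun ω _ => mul_nonneg (hx ω).le ENNReal.toReal_nonneg)]

end IsMinimizer

theorem continuousAt_minimizer {K : Set (Ω → ℝ≥0∞)} (hK : IsCompact K) (hmid : MidpointStrict K)
    (hfin : ∃ f ∈ K, ∀ ω, f ω ≠ ∞) {lam : (Ω → ℝ) → Ω → ℝ≥0∞}
    (hlam : ∀ x, IsMinimizer K x (lam x)) {x : Ω → ℝ} (hx : ∀ ω, 0 < x ω) :
    ContinuousAt lam x := by
  rw [ContinuousAt, tendsto_iff_ultrafilter]
  intro l hl
  obtain ⟨g, hgK, hg⟩ := hK.ultrafilter_le_nhds (l.map lam)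
    (le_principal_iff.2 (Ultrafilter.mem_map.2 (univ_mem' fun y => (hlam y).1)))
  have hcoord : ∀ ω, Tendsto (fun y : Ω → ℝ => ENNReal.ofReal (y ω)) l
      (nhds (ENNReal.ofReal (x ω))) := fun ω =>
    (ENNReal.continuous_ofReal.comp (continuous_apply ω)).continuousAt.tendsto.mono_left hl
  have hlim : Tendsto lam l (nhds g) := hg
  rw [tendsto_pi_nhds] at hlim
  have hpos : ∀ ω, ENNReal.ofReal (x ω) ≠ 0 := fun ω => by simpa using hx ω
  have hmin : IsMinimizer K x g := by
    refine ⟨hgK, fun f hf => ?_⟩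
    have h1 : Tendsto (fun y => ∑ ω, ENNReal.ofReal (y ω) * lam y ω) l
        (nhds (∑ ω, ENNReal.ofReal (x ω) * g ω)) :=
      tendsto_finsetSum _ fun ω _ => ENNReal.Tendsto.mul (hcoord ω) (Or.inl (hpos ω)) (hlim ω)
        (Or.inr ENNReal.ofReal_ne_top)
    have h2 : Tendsto (fun y : Ω → ℝ => ∑ ω, ENNReal.ofReal (y ω) * f ω) l
        (nhds (∑ ω, ENNReal.ofReal (x ω) * f ω)) :=
      tendsto_finsetSum _ fun ω _ => ENNReal.Tendsto.mul (hcoord ω) (Or.inl (hpos ω))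
        tendsto_const_nhds (Or.inr ENNReal.ofReal_ne_top)
    exact le_of_tendsto_of_tendsto' h1 h2 fun y => (hlam y).2 f hf
  rw [(hlam x).unique hmid hfin hx hmin]
  exact hg

theorem eventually_forall_pos {x : Ω → ℝ} (hx : ∀ ω, 0 < x ω) :
    ∀ᶠ y in nhds x, ∀ ω, 0 < y ω :=
  eventually_all.2 fun ω => (continuous_apply ω).continuousAt.eventually (lt_mem_nhds (hx ω))

/-- The linear functional `v ↦ ∑ ω, v ω * c ω`. -/
def weightedSumCLM (c : Ω → ℝ) : (Ω → ℝ) →L[ℝ] ℝ :=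
  ∑ ω, c ω • ContinuousLinearMap.proj (R := ℝ) (φ := fun _ : Ω => ℝ) ω

theorem weightedSumCLM_apply (c v : Ω → ℝ) : weightedSumCLM c v = ∑ ω, v ω * c ω := by
  simp [weightedSumCLM, mul_comm]

theorem hasFDerivAt_of_supergradient {F : (Ω → ℝ) → ℝ} {c : (Ω → ℝ) → Ω → ℝ} {x : Ω → ℝ}
    (hc : ContinuousAt c x)
    (hF : ∀ᶠ y in nhds x, F y = ∑ ω, y ω * c y ω)
    (hle : ∀ᶠ y in nhds x, F y ≤ ∑ ω, y ω * c x ω)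
    (hle' : ∀ᶠ y in nhds x, F x ≤ ∑ ω, x ω * c y ω) :
    HasFDerivAt F (weightedSumCLM (c x)) x := by
  rw [hasFDerivAt_iff_isLittleO, Asymptotics.isLittleO_iff]
  intro ε hε
  have hlim : Tendsto (fun y => ∑ ω, |c y ω - c x ω|) (nhds x) (nhds 0) := by
    have : Tendsto (fun y => ∑ ω, |c y ω - c x ω|) (nhds x)
        (nhds (∑ ω, |c x ω - c x ω|)) :=
      tendsto_finsetSum _ fun ω _ =>
        ((tendsto_pi_nhds.1 hc ω).sub tendsto_const_nhds).abs
    simpa using this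
  have hFx := hF.self_of_nhds
  filter_upwards [hF, hle, hle', hlim.eventually (gt_mem_nhds hε)] with y h1 h2 h3 h4
  rw [weightedSumCLM_apply]
  have e1 : ∑ ω, (y - x) ω * c x ω = ∑ ω, y ω * c x ω - ∑ ω, x ω * c x ω := by
    simp only [Pi.sub_apply, sub_mul, Finset.sum_sub_distrib]
  have e2 : ∑ ω, (y - x) ω * (c y ω - c x ω) = ∑ ω, y ω * c y ω - ∑ ω, x ω * c y ω
      - (∑ ω, y ω * c x ω - ∑ ω, x ω * c x ω) := by
    simp only [Pi.sub_apply, sub_mul, mul_sub, Finset.sum_sub_distrib]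
  have e3 : |∑ ω, (y - x) ω * (c y ω - c x ω)| ≤ ε * ‖y - x‖ :=
    calc _ ≤ ∑ ω, |(y - x) ω * (c y ω - c x ω)| := Finset.abs_sum_le_sum_abs _ _
      _ ≤ ∑ ω, ‖y - x‖ * |c y ω - c x ω| := by
          refine Finset.sum_le_sum fun ω _ => ?_
          rw [abs_mul]
          exact mul_le_mul_of_nonneg_right (norm_le_pi_norm (y - x) ω) (abs_nonneg _)
      _ = (∑ ω, |c y ω - c x ω|) * ‖y - x‖ := by rw [← Finset.mul_sum, mul_comm]
      _ ≤ ε * ‖y - x‖ := mul_le_mul_of_nonneg_right h4.le (norm_nonneg _)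
  refine le_trans ?_ e3
  rw [Real.norm_eq_abs, abs_of_nonpos (by linarith)]
  refine le_trans ?_ (neg_le_abs _)
  linarith

theorem hasFDerivAt_toReal_iInf {K : Set (Ω → ℝ≥0∞)} (hK : IsCompact K)
    (hmid : MidpointStrict K) (hfin : ∃ f ∈ K, ∀ ω, f ω ≠ ∞) {lam : (Ω → ℝ) → Ω → ℝ≥0∞}
    (hlam : ∀ x, IsMinimizer K x (lam x)) {x : Ω → ℝ} (hx : ∀ ω, 0 < x ω) :
    HasFDerivAt (fun y : Ω → ℝ => (⨅ f ∈ K, ∑ ω, ENNReal.ofReal (y ω) * f ω).toReal)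
      (weightedSumCLM fun ω => (lam x ω).toReal) x := by
  have hft : ∀ y : Ω → ℝ, (∀ ω, 0 < y ω) → ∀ ω, lam y ω ≠ ∞ :=
    fun y hy => (hlam y).ne_top hfin hy
  refine hasFDerivAt_of_supergradient (c := fun y ω => (lam y ω).toReal) ?_ ?_ ?_ ?_
  · refine tendsto_pi_nhds.2 fun ω => (ENNReal.tendsto_toReal (hft x hx ω)).comp ?_
    exact tendsto_pi_nhds.1 (continuousAt_minimizer hK hmid hfin hlam hx) ω
  · filter_upwards [eventually_forall_pos hx] with y hy
    exact (hlam y).toReal_iInf hy (hft y hy)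
  · filter_upwards [eventually_forall_pos hx] with y hy
    rw [(hlam y).toReal_iInf hy (hft y hy)]
    exact (hlam y).sum_toReal_le hy (hft y hy) (hlam x).1 (hft x hx)
  · filter_upwards [eventually_forall_pos hx] with y hy
    rw [(hlam x).toReal_iInf hx (hft x hx)]
    exact (hlam x).sum_toReal_le hx (hft x hx) (hlam y).1 (hft y hy)

/-- Lemma 9 of the paper: on the open positive orthant the generalized entropy is a
finite attained minimum; on `𝒫°(Ω)` the minimizer `γ_π` is unique and finite, `H` is
differentiable with gradient `γ_π`, and `π ↦ γ_π` is continuous. -/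
theorem entropy_gradient
    {Ω : Type*} [Fintype Ω] [Nonempty Ω]
    (Λ : Set (Ω → ℝ≥0∞))
    (hcomp : IsCompact Λ) (hfin : ∃ g ∈ Λ, ∀ ω, g ω ≠ ∞)
    (η : ℝ) (hη : 0 < η) :
    -- the infimum is finite and attained on the open positive orthant
    (∀ x : Ω → ℝ, (∀ ω, 0 < x ω) →
      entropyE η Λ x ≠ ∞ ∧
      ∃ g ∈ expHull η Λ, ∑ ω, ENNReal.ofReal (x ω) * g ω = entropyE η Λ x) ∧
    ∃ lam : (Ω → ℝ) → Ω → ℝ≥0∞,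
      (∀ π ∈ {π ∈ stdSimplex ℝ Ω | ∀ ω, 0 < π ω},
        -- (a) `lam π` is the unique minimizer, with finite coordinates
        lam π ∈ expHull η Λ ∧ (∀ ω, lam π ω ≠ ∞) ∧
        (∑ ω, ENNReal.ofReal (π ω) * lam π ω = entropyE η Λ π) ∧
        (∀ g ∈ expHull η Λ,
          (∑ ω, ENNReal.ofReal (π ω) * g ω = entropyE η Λ π) → g = lam π) ∧
        -- (b) `H` is differentiable at `π` with gradient `lam π`
        DifferentiableAt ℝ (entropy η Λ) π ∧
        (∀ v : Ω → ℝ, fderiv ℝ (entropy η Λ) π v = ∑ ω, v ω * (lam π ω).toReal)) ∧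
      -- (c) the minimizer depends continuously on `π`
      ContinuousOn lam {π ∈ stdSimplex ℝ Ω | ∀ ω, 0 < π ω} := by
  have hK := isCompact_expHull hη hcomp
  have hmid := midpointStrict_expHull hη Λ
  have hfinK : ∃ f ∈ expHull η Λ, ∀ ω, f ω ≠ ∞ := by
    obtain ⟨g, hg, hgt⟩ := hfin
    exact ⟨g, subset_expHull hη Λ hg, hgt⟩
  have hne : (expHull η Λ).Nonempty := by
    obtain ⟨g, hg, -⟩ := hfinK
    exact ⟨g, hg⟩
  choose lam hlam using exists_isMinimizer hK hne
  refine ⟨fun x _ => ⟨?_, lam x, (hlam x).1, (hlam x).sum_eq_iInf⟩, lam, ?_, ?_⟩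
  · exact ne_of_eq_of_ne (hlam x).sum_eq_iInf.symm ((hlam x).sum_ne_top hfinK)
  · rintro π ⟨-, hπ⟩
    have hderiv : HasFDerivAt (entropy η Λ) (weightedSumCLM fun ω => (lam π ω).toReal) π :=
      hasFDerivAt_toReal_iInf hK hmid hfinK hlam hπ
    refine ⟨(hlam π).1, (hlam π).ne_top hfinK hπ, (hlam π).sum_eq_iInf, fun g hg h => ?_,
      hderiv.differentiableAt, fun v => ?_⟩
    · exact (IsMinimizer.of_sum_eq_iInf hg h).unique hmid hfinK hπ (hlam π)
    · rw [hderiv.fderiv, weightedSumCLM_apply]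
  · exact fun π hπ => (continuousAt_minimizer hK hmid hfinK hlam hπ.2).continuousWithinAt
end
end

section
/- Let Ω be a finite nonempty set and q : 𝒫°(Ω) × Ω → ℝ a nonnegative function such that π ↦ q(π,ω) is continuous on 𝒫°(Ω) for each ω ∈ Ω, and let C ∈ [0,∞) satisfy ∑_{ω∈Ω} π(ω)·q(π,ω) ≤ C for all π ∈ 𝒫°(Ω). Then there exists a sequence π⁽ⁱ⁾ ∈ 𝒫°(Ω) (i ∈ ℕ) such that π⁽ⁱ⁾ converges in 𝒫(Ω), for every ω ∈ Ω the sequence q(π⁽ⁱ⁾,ω) converges, and lim_{i→∞} q(π⁽ⁱ⁾,ω) ≤ C for every ω ∈ Ω. -/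
open scoped ENNReal BigOperators
open Filter

noncomputable section

variable {Ω : Type*} [Fintype Ω]

/-- A finite set `A` is dominant for the family of rankings `r` if no point `t` is ranked strictly
above the lowest element of `A` by all of the rankings. -/
def IsDominant {ι X L : Type*} [LinearOrder L] (r : ι → X → L) (A : Finset X) : Prop :=
  ∀ t, ∃ i, ∀ s ∈ A, r i t ≤ r i s

section Scarf

variable {ι X L : Type*} [LinearOrder L] {r : ι → X → L}

lemma IsDominant.mono {A B : Finset X} (hA : IsDominant r A) (h : B ⊆ A) : IsDominant r B :=
  fun t => (hA t).imp fun _ hi s hs => hi s (h hs)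

/-- The lowest elements of a dominant set for the various rankings exhaust the set. -/
lemma IsDominant.exists_argmin (hr : ∀ i, Function.Injective (r i)) {A : Finset X}
    (hA : IsDominant r A) (hne : A.Nonempty) :
    ∃ m : ι → X, (∀ i, m i ∈ A) ∧ (∀ i, ∀ s ∈ A, r i (m i) ≤ r i s) ∧ ∀ s ∈ A, ∃ i, m i = s := by
  choose m hm hmin using fun i => A.exists_min_image (r i) hne
  refine ⟨m, hm, hmin, fun s hs => ?_⟩
  obtain ⟨i, hi⟩ := hA s
  exact ⟨i, hr i (le_antisymm (hmin i s hs) (hi _ (hm i)))⟩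

variable [Fintype ι] [DecidableEq ι] [DecidableEq X]

/-- A dominant set with one element fewer than there are rankings is contained in exactly two
dominant sets with one more element, as long as every set of points ranked above its lowest
elements by all rankings but one is nonempty. -/
lemma IsDominant.exists_pair_insert [Fintype X] (hr : ∀ i, Function.Injective (r i)) {B : Finset X}
    (hB : IsDominant r B) (hne : B.Nonempty) (hcard : B.card + 1 = Fintype.card ι)
    (hex : ∀ j, ∃ t, ∀ k, k ≠ j → ∃ s ∈ B, r k s < r k t) :
    ∃ ta tb, ta ≠ tb ∧ ta ∉ B ∧ tb ∉ B ∧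
      ∀ t, (t ∉ B ∧ IsDominant r (insert t B)) ↔ t = ta ∨ t = tb := by
  obtain ⟨m, hm, hmin, hsurj⟩ := hB.exists_argmin hr hne
  obtain ⟨a, -, b, -, hab, hmab⟩ := Finset.exists_ne_map_eq_of_card_lt_of_maps_to
    (s := Finset.univ) (t := B) (f := m) (by rw [Finset.card_univ]; omega) (fun i _ => hm i)
  have hsurj' : ∀ j, j = a ∨ j = b → ∀ s ∈ B, ∃ k, k ≠ j ∧ m k = s := by
    intro j hj s hs
    obtain ⟨k, rfl⟩ := hsurj s hs
    by_cases hkj : k = j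
    · rcases hj with rfl | rfl
      · exact ⟨b, hab.symm, by rw [hkj, hmab]⟩
      · exact ⟨a, hab, by rw [hkj, hmab]⟩
    · exact ⟨k, hkj, rfl⟩
  have hinj : ∀ j, j = a ∨ j = b → ∀ k l, k ≠ j → l ≠ j → m k = m l → k = l := by
    intro j hj k l hk hl hkl
    have himg : (Finset.univ.erase j).image m = B := by
      ext s
      simp only [Finset.mem_image, Finset.mem_erase, Finset.mem_univ, and_true]
      exact ⟨fun ⟨k, _, h⟩ => h ▸ hm k, hsurj' j hj s⟩
    have : Set.InjOn m (Finset.univ.erase j : Finset ι) := by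
      apply Finset.card_image_iff.1
      rw [himg, Finset.card_erase_of_mem (Finset.mem_univ _), Finset.card_univ]
      omega
    exact this (by simpa using hk) (by simpa using hl) hkl
  have hmax : ∀ j, j = a ∨ j = b → ∃ t, (∀ k, k ≠ j → r k (m k) < r k t) ∧ t ∉ B ∧
      IsDominant r (insert t B) ∧
      ∀ u, (∀ k, k ≠ j → r k (m k) < r k u) → IsDominant r (insert u B) → u = t := by
    intro j hj
    obtain ⟨t, ht, htmax⟩ := (Finset.univ.filter
      fun t => ∀ k, k ≠ j → r k (m k) < r k t).exists_max_image (r j) (by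
        obtain ⟨t, ht⟩ := hex j
        refine ⟨t, Finset.mem_filter.2 ⟨Finset.mem_univ _, fun k hk => ?_⟩⟩
        obtain ⟨s, hs, hst⟩ := ht k hk
        exact (hmin k s hs).trans_lt hst)
    simp only [Finset.mem_filter, Finset.mem_univ, true_and] at ht htmax
    have low : ∀ u, (∀ k, k ≠ j → r k (m k) < r k u) → ∀ s ∈ B, r j u ≤ r j s := by
      intro u hu
      obtain ⟨i, hi⟩ := hB u
      by_cases hij : i = j
      · exact hij ▸ hi
      · exact absurd (hi _ (hm i)) (hu i hij).not_ge
    refine ⟨t, ht, fun htB => ?_, fun u => ?_, fun u hu hdom => ?_⟩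
    · obtain ⟨k, hk, rfl⟩ := hsurj' j hj t htB
      exact lt_irrefl _ (ht k hk)
    · by_cases hu : ∀ k, k ≠ j → r k (m k) < r k u
      · refine ⟨j, fun s hs => ?_⟩
        rcases Finset.mem_insert.1 hs with rfl | hs
        · exact htmax u hu
        · exact low u hu s hs
      · push Not at hu
        obtain ⟨k, hk, hku⟩ := hu
        refine ⟨k, fun s hs => ?_⟩
        rcases Finset.mem_insert.1 hs with rfl | hs
        · exact hku.trans (ht k hk).le
        · exact hku.trans (hmin k s hs)
    · obtain ⟨i, hi⟩ := hdom t
      by_cases hij : i = j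
      · subst hij
        exact hr i (le_antisymm (htmax u hu) (hi u (Finset.mem_insert_self _ _)))
      · exact absurd (hi _ (Finset.mem_insert_of_mem (hm i))) (ht i hij).not_ge
  obtain ⟨ta, hta, htaB, hdoma, huna⟩ := hmax a (Or.inl rfl)
  obtain ⟨tb, htb, htbB, hdomb, hunb⟩ := hmax b (Or.inr rfl)
  refine ⟨ta, tb, ?_, htaB, htbB, fun t => ⟨fun ⟨htB, hdom⟩ => ?_, ?_⟩⟩
  · rintro rfl
    obtain ⟨i, hi⟩ := hB ta
    by_cases hia : i = a
    · exact absurd (hi _ (hm i)) (htb i (hia ▸ hab)).not_ge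
    · exact absurd (hi _ (hm i)) (hta i hia).not_ge
  · obtain ⟨m', hm', hmin', hsurj''⟩ := hdom.exists_argmin hr (Finset.insert_nonempty _ _)
    have hinj' : Set.InjOn m' (Finset.univ : Finset ι) := by
      apply Finset.card_image_iff.1
      have : Finset.univ.image m' = insert t B := by
        ext s
        simp only [Finset.mem_image, Finset.mem_univ, true_and]
        exact ⟨fun ⟨k, h⟩ => h ▸ hm' k, hsurj'' s⟩
      rw [this, Finset.card_insert_of_notMem htB, hcard, Finset.card_univ]
    obtain ⟨j, hj⟩ := hsurj'' t (Finset.mem_insert_self _ _)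
    have hne' : ∀ k, k ≠ j → m' k ∈ B := by
      intro k hk
      refine (Finset.mem_insert.1 (hm' k)).resolve_left fun h => hk ?_
      exact hinj' (by simp) (by simp) (h.trans hj.symm)
    have hmm : ∀ k, k ≠ j → m' k = m k := fun k hk => hr k <| le_antisymm
      (hmin' k _ (Finset.mem_insert_of_mem (hm k))) (hmin k _ (hne' k hk))
    have hlt : ∀ k, k ≠ j → r k (m k) < r k t := by
      intro k hk
      rw [← hmm k hk]
      refine lt_of_le_of_ne (hmin' k _ (Finset.mem_insert_self _ _)) fun h => htB ?_
      rw [← hr k h]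
      exact hne' k hk
    have hjab : j = a ∨ j = b := by
      by_contra! h
      refine hab (hinj' (by simp) (by simp) ?_)
      rw [hmm a h.1.symm, hmm b h.2.symm, hmab]
    rcases hjab with rfl | rfl
    · exact Or.inl (huna t hlt hdom)
    · exact Or.inr (hunb t hlt hdom)
  · rintro (rfl | rfl)
    · exact ⟨htaB, hdoma⟩
    · exact ⟨htbB, hdomb⟩

/-- A set with as many elements as there are colors, but missing some color, has an even number of
subsets of one element less that carry exactly the colors other than `i₀`. -/
lemma even_card_filter_image_eq_erase (c : X → ι) (i₀ : ι) {A : Finset X}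
    (hA : A.card = Fintype.card ι) (hc : A.image c ≠ Finset.univ) :
    Even (A.powerset.filter fun B => B.card + 1 = Fintype.card ι ∧
      B.image c = Finset.univ.erase i₀).card := by
  rcases Finset.eq_empty_or_nonempty (A.powerset.filter fun B => B.card + 1 = Fintype.card ι ∧
      B.image c = Finset.univ.erase i₀) with h | ⟨B, hB⟩
  · simp [h]
  obtain ⟨hBA, hcard, himg⟩ : B ⊆ A ∧ B.card + 1 = Fintype.card ι ∧
      B.image c = Finset.univ.erase i₀ := by simpa using hB
  have key : ∀ B' : Finset X, B'.card + 1 = Fintype.card ι → B'.image c = Finset.univ.erase i₀ →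
      Set.InjOn c B' := by
    intro B' h1 h2
    apply Finset.card_image_iff.1
    rw [h2, Finset.card_erase_of_mem (Finset.mem_univ _), Finset.card_univ]
    omega
  have sub : ∀ B' ⊆ A, B'.card + 1 = Fintype.card ι → ∃ x ∈ A, x ∉ B' ∧ B' = A.erase x := by
    intro B' hB' h1
    obtain ⟨x, hx⟩ := Finset.exists_of_ssubset
      (Finset.ssubset_iff_subset_ne.2 ⟨hB', fun h => by rw [h] at h1; omega⟩)
    refine ⟨x, hx.1, hx.2, Finset.eq_of_subset_of_card_le (fun y hy => ?_) ?_⟩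
    · exact Finset.mem_erase.2 ⟨fun h => hx.2 (h ▸ hy), hB' hy⟩
    · rw [Finset.card_erase_of_mem hx.1]; omega
  obtain ⟨x, hxA, hxB, rfl⟩ := sub B hBA hcard
  have hcx : c x ≠ i₀ := by
    intro h
    apply hc
    rw [← Finset.insert_erase hxA, Finset.image_insert, himg, h,
      Finset.insert_erase (Finset.mem_univ _)]
  obtain ⟨y, hy, hyx⟩ : ∃ y ∈ A.erase x, c y = c x := by
    have : c x ∈ (A.erase x).image c := by rw [himg]; simpa using hcx
    simpa using this
  have hyne : y ≠ x := Finset.ne_of_mem_erase hy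
  have hyA : y ∈ A := Finset.mem_of_mem_erase hy
  have himg' : (A.erase y).image c = Finset.univ.erase i₀ := by
    rw [← himg]
    ext i
    simp only [Finset.mem_image, Finset.mem_erase]
    constructor
    · rintro ⟨z, ⟨hz, hzA⟩, rfl⟩
      by_cases hzx : z = x
      · exact ⟨y, ⟨hyne, hyA⟩, by rw [hyx, hzx]⟩
      · exact ⟨z, ⟨hzx, hzA⟩, rfl⟩
    · rintro ⟨z, ⟨hz, hzA⟩, rfl⟩
      by_cases hzy : z = y
      · exact ⟨x, ⟨hyne.symm, hxA⟩, by rw [← hyx, hzy]⟩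
      · exact ⟨z, ⟨hzy, hzA⟩, rfl⟩
  have : (A.powerset.filter fun B => B.card + 1 = Fintype.card ι ∧
      B.image c = Finset.univ.erase i₀) = {A.erase x, A.erase y} := by
    ext B'
    simp only [Finset.mem_filter, Finset.mem_powerset, Finset.mem_insert, Finset.mem_singleton]
    constructor
    · rintro ⟨h1, h2, h3⟩
      obtain ⟨z, hzA, hzB, rfl⟩ := sub B' h1 h2
      by_contra! h
      have hxz : x ≠ z := fun hh => h.1 (by rw [hh])
      have hyz : y ≠ z := fun hh => h.2 (by rw [hh])
      exact hyne (key _ h2 h3 (by simp [hyz, hyA]) (by simp [hxz, hxA]) hyx)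
    · rintro (rfl | rfl)
      · exact ⟨hBA, hcard, himg⟩
      · refine ⟨Finset.erase_subset _ _, ?_, himg'⟩
        rw [Finset.card_erase_of_mem hyA, ← hcard, Finset.card_erase_of_mem hxA]
  rw [this, Finset.card_pair]
  · decide
  · intro h
    have : y ∈ A.erase y := h ▸ hy
    simp at this

/-- The only point outside the set of slack points other than `e i₀` that yields a dominant set when
adjoined to it is the ordinary point ranked highest by `i₀`. -/
lemma isDominant_insert_slack_iff (hr : ∀ i, Function.Injective (r i)) {e : ι → X}
    (hmin : ∀ i x, r i (e i) ≤ r i x)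
    (hmax : ∀ i j x, i ≠ j → x ∉ Set.range e → r i x < r i (e j)) (i₀ : ι) {t₀ : X}
    (ht₀ : t₀ ∉ Set.range e) (htop : ∀ t ∉ Set.range e, r i₀ t ≤ r i₀ t₀) (t : X) :
    (t ∉ (Finset.univ.erase i₀).image e ∧ IsDominant r (insert t ((Finset.univ.erase i₀).image e)))
      ↔ t = t₀ := by
  constructor
  · rintro ⟨htB, hdom⟩
    have ht : t ∉ Set.range e := by
      rintro ⟨j, rfl⟩
      have hj : j = i₀ := by
        by_contra hj
        exact htB (Finset.mem_image.2 ⟨j, by simp [hj], rfl⟩)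
      obtain ⟨i, hi⟩ := hdom t₀
      have : e i ∈ insert (e j) ((Finset.univ.erase i₀).image e) := by
        by_cases h : i = i₀
        · simp [h, hj]
        · exact Finset.mem_insert_of_mem (Finset.mem_image.2 ⟨i, by simp [h], rfl⟩)
      exact ht₀ ⟨i, hr i (le_antisymm (hmin i _) (hi _ this))⟩
    obtain ⟨i, hi⟩ := hdom t₀
    by_cases h : i = i₀
    · subst h
      exact hr i (le_antisymm (htop t ht) (hi t (Finset.mem_insert_self _ _)))
    · have := hi (e i) (Finset.mem_insert_of_mem (Finset.mem_image.2 ⟨i, by simp [h], rfl⟩))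
      exact absurd ⟨i, hr i (le_antisymm (hmin i _) this)⟩ ht₀
  · rintro rfl
    refine ⟨fun h => ?_, fun u => ?_⟩
    · obtain ⟨j, -, hj⟩ := Finset.mem_image.1 h
      exact ht₀ ⟨j, hj⟩
    · by_cases hu : u ∈ Set.range e
      · obtain ⟨l, rfl⟩ := hu
        exact ⟨l, fun s _ => hmin l s⟩
      · refine ⟨i₀, fun s hs => ?_⟩
        rcases Finset.mem_insert.1 hs with rfl | hs
        · exact htop u hu
        · obtain ⟨l, hl, rfl⟩ := Finset.mem_image.1 hs
          exact (hmax i₀ l u (Finset.ne_of_mem_erase hl).symm hu).le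

/-- A combinatorial lemma of Scarf: if every ranking `i` has a slack point `e i` at the bottom,
whereas the other slack points are above all ordinary points, then for every coloring giving `e i`
the color `i` some dominant set carries all colors. -/
theorem exists_isDominant_image_eq_univ [Nonempty ι] [Fintype X]
    (hr : ∀ i, Function.Injective (r i)) {e : ι → X} (hmin : ∀ i x, r i (e i) ≤ r i x)
    (hmax : ∀ i j x, i ≠ j → x ∉ Set.range e → r i x < r i (e j))
    (hord : ∃ x, x ∉ Set.range e) (c : X → ι) (hce : ∀ i, c (e i) = i) :
    ∃ A, IsDominant r A ∧ A.image c = Finset.univ := by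
  classical
  by_contra! hno
  obtain ⟨i₀⟩ := ‹Nonempty ι›
  have einj : Function.Injective e := Function.LeftInverse.injective hce
  have hpos : 0 < Fintype.card ι := Fintype.card_pos_iff.2 ⟨i₀⟩
  set rooms : Finset (Finset X) :=
    Finset.univ.filter fun A => A.card = Fintype.card ι ∧ IsDominant r A with hrooms
  set doors : Finset (Finset X) :=
    Finset.univ.filter fun B => (B.card + 1 = Fintype.card ι ∧
      B.image c = Finset.univ.erase i₀) ∧ IsDominant r B with hdoors
  have hcount := Finset.sum_card_bipartiteAbove_eq_sum_card_bipartiteBelow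
    (s := doors) (t := rooms) (fun B A => B ⊆ A)
  have heven : Even (∑ A ∈ rooms, (doors.bipartiteBelow (fun B A => B ⊆ A) A).card) := by
    refine Finset.even_sum _ fun A hA => ?_
    obtain ⟨hA1, hA2⟩ : A.card = Fintype.card ι ∧ IsDominant r A := by simpa [hrooms] using hA
    have heq : doors.bipartiteBelow (fun B A => B ⊆ A) A = A.powerset.filter fun B =>
        B.card + 1 = Fintype.card ι ∧ B.image c = Finset.univ.erase i₀ := ?_
    · exact heq ▸ even_card_filter_image_eq_erase c i₀ hA1 (hno A hA2)
    ext B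
    simp only [Finset.bipartiteBelow, hdoors, Finset.mem_filter, Finset.mem_univ, true_and,
      Finset.mem_powerset]
    exact ⟨fun h => ⟨h.2, h.1.1⟩, fun h => ⟨⟨h.2, hA2.mono h.1⟩, h.1⟩⟩
  have habove : ∀ B ∈ doors, rooms.bipartiteAbove (fun B A => B ⊆ A) B =
      (Finset.univ.filter fun t => t ∉ B ∧ IsDominant r (insert t B)).image (insert · B) := by
    intro B hB
    obtain ⟨⟨hB1, -⟩, -⟩ := (Finset.mem_filter.1 hB).2
    ext A
    simp only [Finset.bipartiteAbove, hrooms, Finset.mem_filter, Finset.mem_univ, true_and,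
      Finset.mem_image]
    constructor
    · rintro ⟨⟨h1, h2⟩, h3⟩
      obtain ⟨t, htA, htB⟩ := Finset.exists_of_ssubset
        (Finset.ssubset_iff_subset_ne.2 ⟨h3, fun h => by rw [h] at hB1; omega⟩)
      have : insert t B = A := Finset.eq_of_subset_of_card_le (Finset.insert_subset htA h3)
        (by rw [Finset.card_insert_of_notMem htB]; omega)
      exact ⟨t, ⟨htB, this ▸ h2⟩, this⟩
    · rintro ⟨t, ⟨h1, h2⟩, rfl⟩
      exact ⟨⟨by rw [Finset.card_insert_of_notMem h1, hB1], h2⟩, Finset.subset_insert _ _⟩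
  have hcard : ∀ B ∈ doors, (rooms.bipartiteAbove (fun B A => B ⊆ A) B).card =
      (Finset.univ.filter fun t => t ∉ B ∧ IsDominant r (insert t B)).card := by
    intro B hB
    rw [habove B hB]
    refine Finset.card_image_of_injOn fun t ht u _ htu => ?_
    have ht' : t ∉ B := by
      have := (Finset.mem_filter.1 (Finset.mem_coe.1 ht)).2
      exact this.1
    have : t ∈ insert u B := htu ▸ Finset.mem_insert_self t B
    exact (Finset.mem_insert.1 this).resolve_right ht'
  obtain ⟨t₀, ht₀, htop⟩ := (Finset.univ.filter fun t => t ∉ Set.range e).exists_max_image (r i₀)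
    (hord.imp fun x hx => by simpa using hx)
  replace ht₀ : t₀ ∉ Set.range e := by simpa using ht₀
  replace htop : ∀ t ∉ Set.range e, r i₀ t ≤ r i₀ t₀ := fun t ht => htop t (by simpa using ht)
  have hiff := isDominant_insert_slack_iff hr hmin hmax i₀ ht₀ htop
  have himg : ∀ k, ((Finset.univ.erase k).image e).image c = Finset.univ.erase k := by
    intro k
    rw [Finset.image_image, show c ∘ e = id from funext hce, Finset.image_id]
  have hcarde : ∀ k, ((Finset.univ.erase k).image e).card + 1 = Fintype.card ι := by
    intro k
    rw [Finset.card_image_of_injective _ einj, Finset.card_erase_of_mem (Finset.mem_univ _),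
      Finset.card_univ]
    omega
  have hmem : (Finset.univ.erase i₀).image e ∈ doors := by
    refine Finset.mem_filter.2 ⟨Finset.mem_univ _, ⟨hcarde i₀, himg i₀⟩, ?_⟩
    exact ((hiff t₀).2 rfl).2.mono (Finset.subset_insert _ _)
  rw [← hcount, ← Finset.add_sum_erase _ _ hmem, hcard _ hmem] at heven
  have hone : (Finset.univ.filter fun t => t ∉ (Finset.univ.erase i₀).image e ∧
      IsDominant r (insert t ((Finset.univ.erase i₀).image e))).card = 1 := by
    rw [Finset.card_eq_one]
    exact ⟨t₀, by ext t; rw [Finset.mem_filter, hiff t]; simp⟩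
  have hrest : Even (∑ B ∈ doors.erase ((Finset.univ.erase i₀).image e),
      (rooms.bipartiteAbove (fun B A => B ⊆ A) B).card) := by
    refine Finset.even_sum _ fun B hB => ?_
    obtain ⟨hBne, hB⟩ := Finset.mem_erase.1 hB
    obtain ⟨⟨hB1, hB2⟩, hB3⟩ := (Finset.mem_filter.1 hB).2
    rw [hcard B hB]
    have slack : ∀ k, ¬ B ⊆ (Finset.univ.erase k).image e := by
      intro k hk
      have hBk : B = (Finset.univ.erase k).image e :=
        Finset.eq_of_subset_of_card_le hk (by have := hcarde k; omega)
      have hki : k = i₀ := by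
        rw [hBk, himg] at hB2
        by_contra hne
        have : k ∈ Finset.univ.erase i₀ := by simp [hne]
        rw [← hB2] at this
        simp at this
      exact hBne (hki ▸ hBk)
    have hne : B.Nonempty := by
      rw [Finset.nonempty_iff_ne_empty]
      rintro rfl
      exact slack i₀ (Finset.empty_subset _)
    obtain ⟨ta, tb, hab, -, -, hiffB⟩ := hB3.exists_pair_insert hr hne hB1 (by
      refine fun j => ⟨e j, fun k hk => ?_⟩
      by_contra! hcon
      refine slack k fun s hs => ?_
      have hs' : s ∈ Set.range e := by
        by_contra h
        exact (hmax k j s hk h).not_ge (hcon s hs)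
      obtain ⟨l, rfl⟩ := hs'
      refine Finset.mem_image.2 ⟨l, ?_, rfl⟩
      simp only [Finset.mem_erase, Finset.mem_univ, and_true]
      rintro rfl
      exact hk (einj (hr l (le_antisymm (hmin l _) (hcon _ hs)))))
    have : (Finset.univ.filter fun t => t ∉ B ∧ IsDominant r (insert t B)) = {ta, tb} := by
      ext t
      rw [Finset.mem_filter, hiffB t]
      simp
    rw [this, Finset.card_pair hab]
    decide
  rw [hone, Nat.even_add] at heven
  exact absurd (heven.2 hrest) (by decide)

end Scarf

/-- For every coloring of the grid points of a dilated simplex by coordinates, some grid point `x`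
has near it points of each color `i` such that `x i` is not small. -/
theorem exists_grid_point_near_colors {ι : Type*} [Fintype ι] [Nonempty ι] (n : ℕ)
    (c : (ι → ℕ) → ι) :
    ∃ x : ι → ℕ, ∑ i, x i = n ∧ ∀ i, x i ≤ Fintype.card ι ∨
      ∃ y : ι → ℕ, ∑ i, y i = n ∧ c y = i ∧
        ∀ k, y k ≤ x k + Fintype.card ι ∧ x k ≤ y k + Fintype.card ι := by
  classical
  let T := ↥(Finset.piAntidiag (Finset.univ : Finset ι) n)
  have memT : ∀ a : ι → ℕ, a ∈ Finset.piAntidiag Finset.univ n ↔ ∑ i, a i = n := by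
    intro a; simp [Finset.mem_piAntidiag]
  have leT : ∀ (a : T) i, a.1 i ≤ n := fun a i =>
    (Finset.single_le_sum (f := a.1) (fun _ _ => Nat.zero_le _) (Finset.mem_univ i)).trans
      ((memT a.1).1 a.2).le
  let height : ι → T ⊕ ι → ℕ := fun i =>
    Sum.elim (fun a => a.1 i + 1) (fun j => if i = j then 0 else n + 2)
  let r : ι → T ⊕ ι → ℕ ×ₗ Fin (Fintype.card (T ⊕ ι)) := fun i x =>
    toLex (height i x, Fintype.equivFin _ x)
  have hr : ∀ i, Function.Injective (r i) := fun i x y h =>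
    (Fintype.equivFin _).injective (Prod.ext_iff.1 (toLex.injective h)).2
  have hle : ∀ i x y, r i x ≤ r i y → height i x ≤ height i y := by
    intro i x y h
    rcases Prod.Lex.toLex_le_toLex.1 h with h | h
    · exact h.le
    · exact h.1.le
  have hlt : ∀ i x y, height i x < height i y → r i x < r i y := fun i x y h =>
    Prod.Lex.toLex_lt_toLex.2 (Or.inl h)
  have hslack : ∀ i (a : T), r i (Sum.inr i) < r i (Sum.inl a) := fun i a =>
    hlt _ _ _ (by simp [height])
  have hspread : ∀ i j : ι, ∀ a : T, i ≠ j → r i (Sum.inl a) < r i (Sum.inr j) := by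
    intro i j a hij
    apply hlt
    have := leT a i
    simp only [height, Sum.elim_inl, Sum.elim_inr, if_neg hij]
    omega
  obtain ⟨j₀⟩ := ‹Nonempty ι›
  have hpt : ∑ i, (Pi.single j₀ n : ι → ℕ) i = n := by simp
  obtain ⟨A, hA, hAc⟩ := exists_isDominant_image_eq_univ (r := r) hr (e := Sum.inr)
    (by
      rintro i (a | j)
      · exact (hslack i a).le
      · by_cases hij : i = j
        · rw [hij]
        · exact (hlt _ _ _ (by simp [height, hij])).le)
    (by
      rintro i j (a | k) hij hx
      · exact hspread i j a hij
      · exact absurd ⟨k, rfl⟩ hx)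
    ⟨Sum.inl ⟨_, (memT _).2 hpt⟩, by simp⟩
    (Sum.elim (fun a => c a.1) id) (fun i => rfl)
  have hdom : ∀ a : ι → ℕ, ∑ i, a i = n →
      ∃ i, Sum.inr i ∉ A ∧ ∀ s : T, Sum.inl s ∈ A → a i ≤ s.1 i := by
    intro a ha
    obtain ⟨i, hi⟩ := hA (Sum.inl ⟨a, (memT a).2 ha⟩)
    refine ⟨i, fun h => (hslack i _).not_ge (hi _ h), fun s hs => ?_⟩
    simpa [height] using hle _ _ _ (hi _ hs)
  have hcol : ∀ i, Sum.inr i ∉ A → ∃ s : T, Sum.inl s ∈ A ∧ c s.1 = i := by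
    intro i hi
    have : i ∈ A.image (Sum.elim (fun a : T => c a.1) id) :=
      (Finset.ext_iff.1 hAc i).2 (Finset.mem_univ i)
    obtain ⟨a | j, hx, hxi⟩ := Finset.mem_image.1 this
    · exact ⟨a, hx, hxi⟩
    · exact absurd ((show j = i from hxi) ▸ hx) hi
  obtain ⟨i₁, hi₁, -⟩ := hdom _ hpt
  obtain ⟨x, hxA, -⟩ := hcol i₁ hi₁
  let S : Finset T := Finset.univ.filter fun s => Sum.inl s ∈ A
  have memS : ∀ s : T, s ∈ S ↔ Sum.inl s ∈ A := by simp [S]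
  choose μ hμ hμmin using fun i => S.exists_min_image (fun s => s.1 i) ⟨x, (memS x).2 hxA⟩
  let m : ι → ℕ := fun i => if Sum.inr i ∈ A then 0 else (μ i).1 i
  have hm : ∀ s : T, Sum.inl s ∈ A → ∀ i, m i ≤ s.1 i := by
    intro s hs i
    by_cases hi : Sum.inr i ∈ A
    · simp [m, hi]
    · simpa [m, hi] using hμmin i s ((memS s).2 hs)
  have hsum : n ≤ ∑ i, m i + Fintype.card ι := by
    by_contra! hlt'
    have hsum1 : ∑ i, (m i + 1) = ∑ i, m i + Fintype.card ι := by
      simp [Finset.sum_add_distrib]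
    obtain ⟨i, hi, his⟩ := hdom
      (fun i => (m i + 1) + (Pi.single j₀ (n - ∑ i, (m i + 1)) : ι → ℕ) i) (by
        rw [Finset.sum_add_distrib, Finset.sum_pi_single']
        simp only [Finset.mem_univ, if_true]
        omega)
    have h1 := his (μ i) ((memS _).1 (hμ i))
    have h2 : m i = (μ i).1 i := by simp [m, hi]
    omega
  have hup : ∀ s : T, Sum.inl s ∈ A → ∀ k, s.1 k ≤ m k + Fintype.card ι := by
    intro s hs k
    have h1 : ∑ i, s.1 i = n := (memT _).1 s.2
    rw [← Finset.add_sum_erase _ _ (Finset.mem_univ k)] at h1 hsum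
    have h2 : ∑ i ∈ Finset.univ.erase k, m i ≤ ∑ i ∈ Finset.univ.erase k, s.1 i :=
      Finset.sum_le_sum fun i _ => hm s hs i
    omega
  refine ⟨x.1, (memT _).1 x.2, fun i => ?_⟩
  by_cases hi : Sum.inr i ∈ A
  · left
    simpa [m, hi] using hup x hxA i
  · right
    obtain ⟨s, hs, hsc⟩ := hcol i hi
    refine ⟨s.1, (memT _).1 s.2, hsc, fun k => ?_⟩
    have h1 := hup x hxA k
    have h2 := hup s hs k
    have h3 := hm x hxA k
    have h4 := hm s hs k
    omega

/-- A continuous payoff vector on the simplex has an equilibrium: a point whose support consists of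
indices of maximal payoff. -/
theorem exists_mem_stdSimplex_forall_pos_le {ι : Type*} [Fintype ι] [Nonempty ι]
    (f : (ι → ℝ) → ι → ℝ) (hf : ∀ i, ContinuousOn (fun x => f x i) (stdSimplex ℝ ι)) :
    ∃ x ∈ stdSimplex ℝ ι, ∀ i, 0 < x i → ∀ k, f x k ≤ f x i := by
  let ε : ℕ → ℝ := fun n => (Fintype.card ι : ℝ) / ((n : ℝ) + 1)
  have hε : Tendsto ε atTop (nhds 0) := tendsto_const_nhds.div_atTop
    (tendsto_atTop_add_const_right _ _ tendsto_natCast_atTop_atTop)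
  have approx : ∀ n : ℕ, ∃ x ∈ stdSimplex ℝ ι, ∀ i, ∃ y ∈ stdSimplex ℝ ι,
      x i ≤ ε n ∨ (dist y x ≤ ε n ∧ ∀ k, f y k ≤ f y i) := by
    intro n
    have hn : (0 : ℝ) < (n : ℝ) + 1 := by positivity
    let p : (ι → ℕ) → ι → ℝ := fun a i => (a i : ℝ) / ((n : ℝ) + 1)
    have hp : ∀ a : ι → ℕ, ∑ i, a i = n + 1 → p a ∈ stdSimplex ℝ ι := by
      refine fun a ha => ⟨fun i => by positivity, ?_⟩
      rw [← Finset.sum_div, ← Nat.cast_sum, ha]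
      push_cast
      exact div_self hn.ne'
    choose c hc using fun a : ι → ℕ => Finite.exists_max (f (p a))
    obtain ⟨x, hx, hxc⟩ := exists_grid_point_near_colors (n + 1) c
    refine ⟨p x, hp x hx, fun i => ?_⟩
    rcases hxc i with h | ⟨y, hy, hyc, hxy⟩
    · exact ⟨p x, hp x hx, Or.inl (div_le_div_of_nonneg_right (by exact_mod_cast h) hn.le)⟩
    · refine ⟨p y, hp y hy, Or.inr ⟨?_, fun k => hyc ▸ hc y k⟩⟩
      refine (dist_pi_le_iff (by positivity)).2 fun k => ?_
      have h1 : (y k : ℝ) ≤ x k + Fintype.card ι := by exact_mod_cast (hxy k).1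
      have h2 : (x k : ℝ) ≤ y k + Fintype.card ι := by exact_mod_cast (hxy k).2
      rw [Real.dist_eq, ← sub_div, abs_div, abs_of_pos hn]
      refine div_le_div_of_nonneg_right (abs_le.2 ⟨?_, ?_⟩) hn.le <;> linarith
  choose x hx y hy hxy using approx
  obtain ⟨z, hz, φ, hφ, hlim⟩ := (isCompact_stdSimplex ℝ ι).tendsto_subseq hx
  refine ⟨z, hz, fun i hi k => ?_⟩
  have hεφ : Tendsto (fun n => ε (φ n)) atTop (nhds 0) := hε.comp hφ.tendsto_atTop
  have hev : ∀ᶠ n in atTop, ε (φ n) < x (φ n) i :=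
    hεφ.eventually_lt ((tendsto_pi_nhds.1 hlim) i) hi
  have hev' : ∀ᶠ n in atTop,
      dist (y (φ n) i) (x (φ n)) ≤ ε (φ n) ∧ ∀ k, f (y (φ n) i) k ≤ f (y (φ n) i) i :=
    hev.mono fun n hn => (hxy (φ n) i).resolve_left hn.not_ge
  have hdist : Tendsto (fun n => dist (x (φ n)) (y (φ n) i)) atTop (nhds 0) :=
    squeeze_zero' (Eventually.of_forall fun _ => dist_nonneg)
      (hev'.mono fun n hn => by rw [dist_comm]; exact hn.1) hεφ
  have hylim : Tendsto (fun n => y (φ n) i) atTop (nhds z) :=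
    (tendsto_iff_of_dist hdist).1 hlim
  have hywithin : Tendsto (fun n => y (φ n) i) atTop (nhdsWithin z (stdSimplex ℝ ι)) :=
    tendsto_nhdsWithin_iff.2 ⟨hylim, Eventually.of_forall fun n => hy (φ n) i⟩
  exact le_of_tendsto_of_tendsto ((hf k z hz).tendsto.comp hywithin)
    ((hf i z hz).tendsto.comp hywithin) (hev'.mono fun n hn => hn.2 k)

/-- If the expectation of a nonnegative continuous function on the open simplex is bounded by `C`,
then its values can be bounded simultaneously by any `C / (1 - t)`. -/
theorem exists_forall_mul_le_of_sum_mul_le {ι : Type*} [Fintype ι] [Nonempty ι]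
    (q : (ι → ℝ) → ι → ℝ) (C : ℝ)
    (hnonneg : ∀ π ∈ {π ∈ stdSimplex ℝ ι | ∀ i, 0 < π i}, ∀ i, 0 ≤ q π i)
    (hcont : ∀ i, ContinuousOn (fun π => q π i) {π ∈ stdSimplex ℝ ι | ∀ i, 0 < π i})
    (hsum : ∀ π ∈ {π ∈ stdSimplex ℝ ι | ∀ i, 0 < π i}, ∑ i, π i * q π i ≤ C)
    {t : ℝ} (ht₀ : 0 < t) (ht₁ : t < 1) :
    ∃ π ∈ {π ∈ stdSimplex ℝ ι | ∀ i, 0 < π i}, ∀ i, (1 - t) * q π i ≤ C := by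
  have hcard : (0 : ℝ) < Fintype.card ι := by exact_mod_cast Fintype.card_pos
  let g : (ι → ℝ) → ι → ℝ := fun x i => t / Fintype.card ι + (1 - t) * x i
  have hg : Set.MapsTo g (stdSimplex ℝ ι) {π ∈ stdSimplex ℝ ι | ∀ i, 0 < π i} := by
    intro x hx
    have hpos : ∀ i, 0 < g x i := fun i =>
      add_pos_of_pos_of_nonneg (by positivity) (mul_nonneg (by linarith) (hx.1 i))
    refine ⟨⟨fun i => (hpos i).le, ?_⟩, hpos⟩
    simp only [g]
    rw [Finset.sum_add_distrib, ← Finset.mul_sum, hx.2, Finset.sum_const, Finset.card_univ,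
      nsmul_eq_mul, mul_div_cancel₀ _ hcard.ne']
    ring
  have hgc : Continuous g := by fun_prop
  obtain ⟨x, hx, hmax⟩ := exists_mem_stdSimplex_forall_pos_le (fun x => q (g x))
    fun i => (hcont i).comp hgc.continuousOn hg
  have hπ := hg hx
  refine ⟨g x, hπ, fun i => ?_⟩
  calc (1 - t) * q (g x) i = ∑ k, (1 - t) * (x k * q (g x) i) := by
        rw [← Finset.mul_sum, ← Finset.sum_mul, hx.2, one_mul]
    _ ≤ ∑ k, g x k * q (g x) k := by
        refine Finset.sum_le_sum fun k _ => ?_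
        have hk : x k * q (g x) i ≤ x k * q (g x) k := by
          rcases (hx.1 k).eq_or_lt with h | h
          · simp [← h]
          · exact mul_le_mul_of_nonneg_left (hmax k h i) h.le
        calc (1 - t) * (x k * q (g x) i) ≤ (1 - t) * (x k * q (g x) k) :=
              mul_le_mul_of_nonneg_left hk (by linarith)
          _ = ((1 - t) * x k) * q (g x) k := by ring
          _ ≤ g x k * q (g x) k := by
              refine mul_le_mul_of_nonneg_right ?_ (hnonneg _ hπ k)
              exact le_add_of_nonneg_left (by positivity)
    _ ≤ C := hsum _ hπ

/-- Lemma 11 of the paper (supermartingale property on the open simplex):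
existence of a converging sequence of non-degenerate forecasts whose limiting
values are bounded by `C`. -/
theorem levin_property_open
    {Ω : Type*} [Fintype Ω] [Nonempty Ω]
    (q : (Ω → ℝ) → Ω → ℝ) (C : ℝ) (hC : 0 ≤ C)
    (hnonneg : ∀ π ∈ {π ∈ stdSimplex ℝ Ω | ∀ ω, 0 < π ω}, ∀ ω : Ω, 0 ≤ q π ω)
    (hcont : ∀ ω : Ω,
      ContinuousOn (fun π => q π ω) {π ∈ stdSimplex ℝ Ω | ∀ ω, 0 < π ω})
    (hsum : ∀ π ∈ {π ∈ stdSimplex ℝ Ω | ∀ ω, 0 < π ω},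
      ∑ ω : Ω, π ω * q π ω ≤ C) :
    ∃ πs : ℕ → Ω → ℝ,
      (∀ i, πs i ∈ {π ∈ stdSimplex ℝ Ω | ∀ ω, 0 < π ω}) ∧
      (∃ π ∈ stdSimplex ℝ Ω, Filter.Tendsto πs Filter.atTop (nhds π)) ∧
      (∀ ω : Ω, ∃ L : ℝ,
        Filter.Tendsto (fun i => q (πs i) ω) Filter.atTop (nhds L) ∧ L ≤ C) := by
  have hden : ∀ n : ℕ, (0 : ℝ) < (n : ℝ) + 2 := fun n => by positivity
  have ht₀ : ∀ n : ℕ, (0 : ℝ) < 1 / ((n : ℝ) + 2) := fun n => one_div_pos.2 (hden n)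
  have ht₁ : ∀ n : ℕ, 1 / ((n : ℝ) + 2) ≤ 1 / 2 := fun n =>
    one_div_le_one_div_of_le two_pos (by linarith [(Nat.cast_nonneg n : (0 : ℝ) ≤ n)])
  choose p hp hpq using fun n : ℕ => exists_forall_mul_le_of_sum_mul_le q C hnonneg hcont hsum
    (ht₀ n) ((ht₁ n).trans_lt (by norm_num))
  have hbound : ∀ n, q (p n) ∈ Set.univ.pi fun _ : Ω => Set.Icc 0 (2 * C) := by
    refine fun n ω _ => ⟨hnonneg _ (hp n) ω, ?_⟩
    have h1 := hpq n ω
    have h2 := mul_le_mul_of_nonneg_right (ht₁ n) (hnonneg _ (hp n) ω)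
    linarith
  obtain ⟨⟨π, L⟩, hmem, φ, hφ, hlim⟩ := ((isCompact_stdSimplex ℝ Ω).prod
    (isCompact_univ_pi fun _ : Ω => isCompact_Icc)).tendsto_subseq
      (x := fun n => (p n, q (p n))) fun n => ⟨(hp n).1, hbound n⟩
  have hlim₁ : Tendsto (fun n => p (φ n)) atTop (nhds π) := (Prod.tendsto_iff _ _).1 hlim |>.1
  have hlim₂ : Tendsto (fun n => q (p (φ n))) atTop (nhds L) := (Prod.tendsto_iff _ _).1 hlim |>.2
  have ht : Tendsto (fun n : ℕ => 1 - 1 / ((n : ℝ) + 2)) atTop (nhds (1 - 0)) :=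
    tendsto_const_nhds.sub (tendsto_const_nhds.div_atTop
      (tendsto_atTop_add_const_right _ _ tendsto_natCast_atTop_atTop))
  refine ⟨fun n => p (φ n), fun n => hp _, ⟨π, hmem.1, hlim₁⟩, fun ω => ⟨L ω, ?_, ?_⟩⟩
  · exact tendsto_pi_nhds.1 hlim₂ ω
  · have := (ht.comp hφ.tendsto_atTop).mul (tendsto_pi_nhds.1 hlim₂ ω)
    rw [sub_zero, one_mul] at this
    exact le_of_tendsto this (Eventually.of_forall fun n => hpq (φ n) ω)
end
end
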